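/- arXiv:2410.18753 — 5 statements merged into one kernel-verified Lean document; each statement's English description precedes it below -/
import Mathlib

section
/- Let G be a group, φ an endomorphism of G, and A an abelian normal subgroup of G with φ(A) ⊆ A. Then for every g ∈ G and every a ∈ A, one has H(a g) = H(g); that is, the subgroup H(g) = { x · (g φ(x) g⁻¹)⁻¹ : x ∈ A } depends only on the coset A g of g. -/
/-- Let `G` be a group, `φ` an endomorphism of `G`, and `A` an abelian normal
subgroup of `G` with `φ(A) ⊆ A`. Then for every `g ∈ G` and `a ∈ A`, `H(a * g) = H(g)`,
where `H(k) = { x * (k * φ x * k⁻¹)⁻¹ : x ∈ A }`. -/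
theorem Hset_depends_only_on_coset {G : Type*} [Group G] (φ : G →* G) (A : Subgroup G)
    [A.Normal] (hab : ∀ x ∈ A, ∀ y ∈ A, x * y = y * x)
    (hinv : ∀ a ∈ A, φ a ∈ A) (g : G) (a : G) (ha : a ∈ A) :
    {y : G | ∃ x ∈ A, y = x * ((a * g) * φ x * (a * g)⁻¹)⁻¹} =
      {y : G | ∃ x ∈ A, y = x * (g * φ x * g⁻¹)⁻¹} := by
  have conj_eq : ∀ x ∈ A, (a * g) * φ x * (a * g)⁻¹ = g * φ x * g⁻¹ := fun x hx => by
    have hmem : g * φ x * g⁻¹ ∈ A := ‹A.Normal›.conj_mem _ (hinv x hx) g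
    calc (a * g) * φ x * (a * g)⁻¹ = a * (g * φ x * g⁻¹) * a⁻¹ := by group
      _ = g * φ x * g⁻¹ := by rw [hab a ha _ hmem, mul_inv_cancel_right]
  ext y
  exact exists_congr fun x => and_congr_right fun hx => by rw [conj_eq x hx]
end

section
/- Let G be a group, φ an endomorphism of G, A an abelian normal subgroup of G with φ(A) ⊆ A, and T ⊆ G a right transversal for A in G, with decomposition maps x_(·) : G → A and t_(·) : G → T such that g = x_g t_g for every g ∈ G. Then for all g, h ∈ G and t ∈ T: h ∈ { a t g φ(a t)⁻¹ : a ∈ A } if and only if both (1) t_h ∈ t t_g φ(t)⁻¹ A, and (2) x_h · ( (t x_g t⁻¹) · x_{t t_g φ(t)⁻¹} )⁻¹ ∈ H(t t_g φ(t)⁻¹), where x_{t t_g φ(t)⁻¹} denotes the A-component of the element t t_g φ(t)⁻¹. -/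
/-- Let `G` be a group, `φ` an endomorphism of `G`, `A` an abelian normal
subgroup of `G` with `φ(A) ⊆ A`, and `T ⊆ G` a right transversal for `A` with decomposition
maps `xc : G → A` and `tc : G → T` such that `g = xc g * tc g` uniquely. Then for
`g, h ∈ G` and `t ∈ T`: `h ∈ { a t g φ(a t)⁻¹ : a ∈ A }` if and only if
(1) `tc h ∈ t * tc g * (φ t)⁻¹ * A`, and
(2) `xc h * ((t * xc g * t⁻¹) * xc (t * tc g * (φ t)⁻¹))⁻¹ ∈ H(t * tc g * (φ t)⁻¹)`,
where `H(k) = { x * (k * φ x * k⁻¹)⁻¹ : x ∈ A }`. -/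
theorem mem_twistedConjugates_iff_components {G : Type*} [Group G] (φ : G →* G)
    (A : Subgroup G) [A.Normal] (hab : ∀ x ∈ A, ∀ y ∈ A, x * y = y * x)
    (hinv : ∀ a ∈ A, φ a ∈ A)
    (T : Set G) (xc tc : G → G)
    (hdecomp : ∀ g : G, xc g ∈ A ∧ tc g ∈ T ∧ g = xc g * tc g)
    (huniq : ∀ g : G, ∀ x ∈ A, ∀ t ∈ T, g = x * t → x = xc g ∧ t = tc g)
    (g h : G) (t : G) (ht : t ∈ T) :
    (∃ a ∈ A, h = (a * t) * g * (φ (a * t))⁻¹) ↔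
      ((∃ a ∈ A, tc h = t * tc g * (φ t)⁻¹ * a) ∧
        xc h * ((t * xc g * t⁻¹) * xc (t * tc g * (φ t)⁻¹))⁻¹ ∈
          {y : G | ∃ x ∈ A, y = x * ((t * tc g * (φ t)⁻¹) * φ x
            * (t * tc g * (φ t)⁻¹)⁻¹)⁻¹}) := by
  obtain ⟨hxg, -, hg⟩ := hdecomp g
  obtain ⟨hxh, hth, hh⟩ := hdecomp h
  have htrans : (a : G) → (a * t) * g * (φ (a * t))⁻¹ =
      a * (t * xc g * t⁻¹) * (t * tc g * (φ t)⁻¹) * (φ a)⁻¹ := by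
    intro a
    conv_lhs => rw [hg]
    simp only [map_mul]
    group
  simp only [htrans, Set.mem_ofPred_eq]
  have hu : t * xc g * t⁻¹ ∈ A := Subgroup.Normal.conj_mem ‹_› _ hxg t
  generalize t * xc g * t⁻¹ = u at hu ⊢
  generalize t * tc g * (φ t)⁻¹ = k
  obtain ⟨hxk, htk, hk⟩ := hdecomp k
  have hconj : ∀ a ∈ A, k * φ a * k⁻¹ ∈ A := fun a ha =>
    Subgroup.Normal.conj_mem ‹_› _ (hinv a ha) k
  have hcomm : ∀ a ∈ A, a * u * (k * φ a * k⁻¹)⁻¹ * xc k =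
      a * (k * φ a * k⁻¹)⁻¹ * (u * xc k) := by
    intro a ha
    rw [mul_assoc a u, hab u hu _ (A.inv_mem (hconj a ha))]
    group
  have hsplit : ∀ a ∈ A, a * u * k * (φ a)⁻¹ =
      a * (k * φ a * k⁻¹)⁻¹ * (u * xc k) * tc k := by
    intro a ha
    rw [← hcomm a ha, mul_assoc _ (xc k), ← hk]
    group
  constructor
  · rintro ⟨a, ha, hha⟩
    rw [hsplit a ha] at hha
    obtain ⟨hx, ht'⟩ := huniq h _ (A.mul_mem (A.mul_mem ha (A.inv_mem (hconj a ha)))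
      (A.mul_mem hu hxk)) _ htk hha
    refine ⟨⟨k⁻¹ * (xc k)⁻¹ * k, ?_, ?_⟩, a, ha, ?_⟩
    · simpa using Subgroup.Normal.conj_mem ‹_› _ (A.inv_mem hxk) k⁻¹
    · rw [← ht', eq_inv_mul_of_mul_eq hk.symm]
      group
    · rw [← hx, mul_inv_cancel_right]
  · rintro ⟨⟨b, hb, htb⟩, a, ha, hxa⟩
    have hone := (huniq (tc h) 1 A.one_mem _ hth (one_mul _).symm).2
    have hkb : tc h = (k * b * k⁻¹ * xc k) * tc k := by
      rw [mul_assoc _ (xc k), ← hk, htb]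
      group
    have htk' : tc k = tc h :=
      (huniq (tc h) _ (A.mul_mem (Subgroup.Normal.conj_mem ‹_› _ hb k) hxk) _ htk hkb).2.trans
        hone.symm
    refine ⟨a, ha, ?_⟩
    rw [hsplit a ha, ← hxa, inv_mul_cancel_right, htk']
    exact hh
end

section
/- Let G be a group, φ an endomorphism of G, and A a finitely generated abelian normal subgroup of G of finite index with φ(A) ⊆ A. Then every φ-twisted conjugacy class of G is a finite union of left cosets of finitely generated subgroups of A: for every g ∈ G there exist m ≤ [G:A], finitely generated subgroups H_1, …, H_m of A, and elements k_1, …, k_m ∈ G such that [g]_φ = ⋃_{i=1}^m H_i k_i. -/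
/-- For an abelian normal subgroup `A` with `φ(A) ⊆ A` and `k : G`, the homomorphism
`a ↦ a * (k * (φ a)⁻¹ * k⁻¹)` from `A` to `G`. -/
def twistedDisplacement {G : Type*} [Group G] (φ : G →* G) (A : Subgroup G) [A.Normal]
    (hab : ∀ x ∈ A, ∀ y ∈ A, x * y = y * x) (hinv : ∀ a ∈ A, φ a ∈ A) (k : G) : A →* G where
  toFun a := a * (k * (φ a)⁻¹ * k⁻¹)
  map_one' := by simp
  map_mul' a b := by
    have hmem (a : A) : k * (φ a)⁻¹ * k⁻¹ ∈ A :=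
      Subgroup.Normal.conj_mem inferInstance _ (A.inv_mem (hinv a a.2)) k
    have hcomm := hab _ (A.mul_mem b.2 (hmem b)) _ (hmem a)
    calc ((a * b : A) : G) * (k * (φ (a * b : A))⁻¹ * k⁻¹)
        = a * (b * (k * (φ b)⁻¹ * k⁻¹) * (k * (φ a)⁻¹ * k⁻¹)) := by
          simp only [Subgroup.coe_mul, map_mul]; group
      _ = a * (k * (φ a)⁻¹ * k⁻¹) * (b * (k * (φ b)⁻¹ * k⁻¹)) := by
          rw [hcomm]; group

/-- Let `G` be a group, `φ` an endomorphism of `G`, and `A` a finitely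
generated abelian normal subgroup of finite index with `φ(A) ⊆ A`. Then every `φ`-twisted
conjugacy class of `G` is a finite union of at most `[G:A]` left cosets of finitely
generated subgroups of `A`. -/
theorem twistedClass_eq_finite_union_of_cosets {G : Type*} [Group G] (φ : G →* G)
    (A : Subgroup G) [A.Normal] (hab : ∀ x ∈ A, ∀ y ∈ A, x * y = y * x)
    (hfg : A.FG) (hfin : A.index ≠ 0) (hinv : ∀ a ∈ A, φ a ∈ A) (g : G) :
    ∃ m : ℕ, m ≤ A.index ∧ ∃ H : Fin m → Subgroup G, ∃ k : Fin m → G,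
      (∀ i, H i ≤ A ∧ (H i).FG) ∧
      {h : G | ∃ c : G, h = c * g * (φ c)⁻¹} =
        ⋃ i, {h : G | ∃ y ∈ H i, h = y * k i} := by
  have : A.FiniteIndex := ⟨hfin⟩
  have : Group.FG A := (Group.fg_iff_subgroup_fg A).2 hfg
  let e : Fin A.index ≃ G ⧸ A := (Finite.equivFin (G ⧸ A)).symm
  let k (i : Fin A.index) : G := (e i).out * g * (φ (e i).out)⁻¹
  refine ⟨A.index, le_rfl, fun i => (twistedDisplacement φ A hab hinv (k i)).range, k,
    fun i => ⟨?_, (Group.fg_iff_subgroup_fg _).1 (Group.fg_range _)⟩, ?_⟩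
  · rintro _ ⟨a, rfl⟩
    exact A.mul_mem a.2
      (Subgroup.Normal.conj_mem inferInstance _ (A.inv_mem (hinv a a.2)) (k i))
  · ext h
    simp only [Set.mem_ofPred_eq, Set.mem_iUnion]
    constructor
    · rintro ⟨c, rfl⟩
      obtain ⟨i, hi⟩ := e.surjective (c : G ⧸ A)
      have hc : (c : G ⧸ A) = ((e i).out : G) := by rw [QuotientGroup.out_eq', hi]
      have ha : c * (e i).out⁻¹ ∈ A := by
        rw [← QuotientGroup.eq_one_iff, QuotientGroup.mk_mul, QuotientGroup.mk_inv, hc,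
          mul_inv_cancel]
      refine ⟨i, _, ⟨⟨_, ha⟩, rfl⟩, ?_⟩
      simp only [twistedDisplacement, MonoidHom.coe_mk, OneHom.coe_mk, map_mul, map_inv, k]
      group
    · rintro ⟨i, _, ⟨a, rfl⟩, rfl⟩
      refine ⟨a * (e i).out, ?_⟩
      simp only [twistedDisplacement, MonoidHom.coe_mk, OneHom.coe_mk, map_mul, k]
      group
end

section
/- Let G be a finitely generated virtually abelian group, Σ a finite subset of G generating G as a monoid, ω : Σ → ℕ₊ a weight function, and φ an endomorphism of G. For each r ∈ ℕ let c(r) denote the number of φ-twisted conjugacy classes of G that contain an element of weight at most r. Then the φ-twisted conjugacy growth series ∑_{r=0}^∞ c(r) z^r ∈ ℚ[[z]] is a rational function: there exist polynomials p, q ∈ ℚ[z] with q(0) ≠ 0 such that q · (∑_{r=0}^∞ c(r) z^r) = p as formal power series. -/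
open scoped Classical

/-- The weight of a group element induced by a weight function `ω` on a generating set `S`:
`0` for the identity, and otherwise the minimum total weight of a word over `S`
representing the element. -/
noncomputable def inducedWeight {G : Type*} [Group G] (S : Finset G) (ω : G → ℕ) (g : G) : ℕ :=
  if g = 1 then 0
  else sInf {w : ℕ | ∃ l : List G, (∀ s ∈ l, s ∈ S) ∧ l.prod = g ∧ (l.map ω).sum = w}

/-- A power series over `ℚ` is rational if it is a quotient `p / q` of polynomials
with `q(0) ≠ 0`. -/
def IsRationalSeries (f : PowerSeries ℚ) : Prop :=
  ∃ p q : Polynomial ℚ, q.coeff 0 ≠ 0 ∧ (q : PowerSeries ℚ) * f = (p : PowerSeries ℚ)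

namespace IsRationalSeries

variable {f g : PowerSeries ℚ}

theorem of_polynomial (p : Polynomial ℚ) : IsRationalSeries (p : PowerSeries ℚ) :=
  ⟨p, 1, by simp, by simp⟩

theorem add (hf : IsRationalSeries f) (hg : IsRationalSeries g) : IsRationalSeries (f + g) := by
  obtain ⟨p, q, hq, h⟩ := hf
  obtain ⟨p', q', hq', h'⟩ := hg
  refine ⟨p * q' + p' * q, q * q', by simp [Polynomial.mul_coeff_zero, hq, hq'], ?_⟩
  push_cast
  rw [← h, ← h']
  ring

theorem polynomial_mul (hf : IsRationalSeries f) (p : Polynomial ℚ) :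
    IsRationalSeries ((p : PowerSeries ℚ) * f) := by
  obtain ⟨p', q, hq, h⟩ := hf
  refine ⟨p * p', q, hq, ?_⟩
  push_cast
  rw [← h]
  ring

theorem of_polynomial_mul {p : Polynomial ℚ} (hp : p.coeff 0 ≠ 0)
    (hf : IsRationalSeries ((p : PowerSeries ℚ) * f)) : IsRationalSeries f := by
  obtain ⟨p', q, hq, h⟩ := hf
  refine ⟨p', q * p, by simp [Polynomial.mul_coeff_zero, hq, hp], ?_⟩
  push_cast
  rw [← h]
  ring

theorem sub (hf : IsRationalSeries f) (hg : IsRationalSeries g) : IsRationalSeries (f - g) := by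
  simpa [sub_eq_add_neg] using hf.add (hg.polynomial_mul (-1))

end IsRationalSeries

section FibreSeries

variable {N : Type*}

/-- The generating function counting the elements of `s` by their weight under `w`. -/
noncomputable def fibreSeries (w : N → ℕ) (s : Set N) : PowerSeries ℚ :=
  PowerSeries.mk fun r => ({x ∈ s | w x = r}.ncard : ℚ)

theorem isRationalSeries_fibreSeries_of_finite (w : N → ℕ) {s : Set N} (hs : s.Finite) :
    IsRationalSeries (fibreSeries w s) := by
  obtain ⟨b, hb⟩ := (hs.image w).bddAbove
  convert IsRationalSeries.of_polynomial
    (PowerSeries.trunc (b + 1) (fibreSeries w s)) using 1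
  ext r
  rw [Polynomial.coeff_coe, PowerSeries.coeff_trunc]
  split_ifs with h
  · rfl
  · have : {x ∈ s | w x = r} = ∅ := by
      ext x
      simp only [Set.mem_ofPred_eq, Set.mem_empty_iff_false, iff_false, not_and]
      intro hx hr
      have := hb (Set.mem_image_of_mem w hx)
      omega
    simp [fibreSeries, this]

theorem fibreSeries_union_add_inter (w : N → ℕ) {s t : Set N}
    (hs : ∀ r, {x ∈ s | w x = r}.Finite) (ht : ∀ r, {x ∈ t | w x = r}.Finite) :
    fibreSeries w (s ∪ t) = fibreSeries w s + fibreSeries w t - fibreSeries w (s ∩ t) := by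
  ext r
  have h := Set.ncard_union_add_ncard_inter {x ∈ s | w x = r} {x ∈ t | w x = r} (hs r) (ht r)
  have h₁ : {x ∈ s | w x = r} ∪ {x ∈ t | w x = r} = {x ∈ s ∪ t | w x = r} := by
    ext x; simp only [Set.mem_union, Set.mem_ofPred_eq]; tauto
  have h₂ : {x ∈ s | w x = r} ∩ {x ∈ t | w x = r} = {x ∈ s ∩ t | w x = r} := by
    ext x; simp only [Set.mem_inter_iff, Set.mem_ofPred_eq]; tauto
  rw [h₁, h₂] at h
  simp only [fibreSeries, map_add, map_sub, PowerSeries.coeff_mk, eq_sub_iff_add_eq]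
  exact_mod_cast h

end FibreSeries

section PeriodicSets

open Pointwise

variable {N : Type*} [AddCommMonoid N]

/-- A subset of a finitely generated `P`-invariant set which is itself `P`-invariant is finitely
generated, provided that `P` is finitely generated (a form of Dickson's lemma). -/
theorem exists_finite_add_eq_of_add_mem {P : AddSubmonoid N} (hP : P.FG) {F V : Set N}
    (hF : F.Finite) (hVF : V ⊆ F + (P : Set N)) (hV : ∀ x ∈ V, ∀ m ∈ P, x + m ∈ V) :
    ∃ F' : Set N, F'.Finite ∧ V = F' + (P : Set N) := by
  obtain ⟨n, g, rfl⟩ := AddSubmonoid.fg_iff_exists_fin_addMonoidHom.1 hP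
  refine ⟨⋃ f ∈ F, (fun u => f + g u) '' {u | Minimal (fun u => f + g u ∈ V) u}, ?_, ?_⟩
  · refine hF.biUnion fun f _ => Set.Finite.image _ ?_
    exact (setOfPred_minimal_antichain _).finite_of_partiallyWellOrderedOn
      (Set.isPWO_of_wellQuasiOrderedLE _)
  · apply subset_antisymm
    · intro x hx
      obtain ⟨f, hf, _, ⟨u, rfl⟩, rfl⟩ := Set.mem_add.1 (hVF hx)
      obtain ⟨v, hvu, hv⟩ :=
        (Set.isPWO_of_wellQuasiOrderedLE {u | f + g u ∈ V}).exists_le_minimal hx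
      obtain ⟨d, rfl⟩ := exists_add_of_le hvu
      refine Set.mem_add.2 ⟨f + g v, ?_, g d, ⟨d, rfl⟩, by simp [add_assoc]⟩
      exact Set.mem_biUnion hf ⟨v, hv, rfl⟩
    · intro x hx
      obtain ⟨y, hy, m, hm, rfl⟩ := Set.mem_add.1 hx
      obtain ⟨f, -, u, hu, rfl⟩ := Set.mem_iUnion₂.1 hy
      exact hV _ hu.1 m hm

theorem mem_closure_cons {p : N} {l : List N} {m : N}
    (hm : m ∈ AddSubmonoid.closure {x | x ∈ p :: l}) :
    ∃ k : ℕ, ∃ m' ∈ AddSubmonoid.closure {x | x ∈ l}, m = k • p + m' := by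
  have : {x | x ∈ p :: l} = {p} ∪ {x | x ∈ l} := by ext; simp
  rw [this, AddSubmonoid.closure_union, AddSubmonoid.mem_sup] at hm
  obtain ⟨y, hy, z, hz, rfl⟩ := hm
  obtain ⟨k, rfl⟩ := AddSubmonoid.mem_closure_singleton.1 hy
  exact ⟨k, z, hz, rfl⟩

theorem closure_le_closure_cons (p : N) (l : List N) :
    AddSubmonoid.closure {x | x ∈ l} ≤ AddSubmonoid.closure {x | x ∈ p :: l} :=
  AddSubmonoid.closure_mono fun _ hx => List.mem_cons_of_mem _ hx

/-- The recursion for the counting function of `T \ U` obtained from translation by `p`. -/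
theorem fibreSeries_translate [IsCancelAdd N] (w : N →+ ℕ) {p : N} {T U : Set N}
    (hT : ∀ x ∈ T, x + p ∈ T) (hU : ∀ x ∈ U, x + p ∈ U)
    (hfin : ∀ r, {x ∈ T | w x = r}.Finite) :
    fibreSeries w (T \ U) = fibreSeries w (T \ (U ∪ (T + {p}))) +
      PowerSeries.X ^ w p * (fibreSeries w (T \ U) - fibreSeries w ({x ∈ T | x + p ∈ U} \ U)) := by
  have hfin' : ∀ r (s : Set N), {x ∈ T \ s | w x = r}.Finite := fun r s =>
    (hfin r).subset fun x hx => ⟨hx.1.1, hx.2⟩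
  have key : ∀ r, {x ∈ T \ U | w x = r + w p}.ncard + {x ∈ {x ∈ T | x + p ∈ U} \ U | w x = r}.ncard
      = {x ∈ T \ (U ∪ (T + {p})) | w x = r + w p}.ncard + {x ∈ T \ U | w x = r}.ncard := by
    intro r
    have h₁ : {x ∈ T \ U | w x = r + w p}.ncard =
        {x ∈ T \ (U ∪ (T + {p})) | w x = r + w p}.ncard +
          ((· + p) '' {x ∈ T | x + p ∉ U ∧ w x = r}).ncard := by
      rw [← Set.ncard_union_eq _ (hfin' _ _)
        (((hfin r).subset fun x hx => ⟨hx.1, hx.2.2⟩).image _)]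
      · congr 1
        ext x
        simp only [Set.mem_ofPred_eq, Set.mem_sdiff, Set.mem_union, Set.add_singleton,
          Set.mem_image, not_or, not_exists, not_and]
        constructor
        · rintro ⟨⟨hx, hxU⟩, hw⟩
          by_cases h : ∃ y ∈ T, y + p = x
          · obtain ⟨y, hy, rfl⟩ := h
            exact Or.inr ⟨y, ⟨hy, hxU, by simpa using hw⟩, rfl⟩
          · push Not at h
            exact Or.inl ⟨⟨hx, hxU, h⟩, hw⟩
        · rintro (⟨⟨hx, hxU, -⟩, hw⟩ | ⟨y, ⟨hy, hyU, hw⟩, rfl⟩)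
          · exact ⟨⟨hx, hxU⟩, hw⟩
          · exact ⟨⟨hT y hy, hyU⟩, by simp [hw]⟩
      · rw [Set.disjoint_left]
        rintro _ hx ⟨y, hy, rfl⟩
        exact hx.1.2 (Or.inr (Set.add_mem_add hy.1 rfl))
    have h₂ : {x ∈ T \ U | w x = r}.ncard = {x ∈ {x ∈ T | x + p ∈ U} \ U | w x = r}.ncard +
        {x ∈ T | x + p ∉ U ∧ w x = r}.ncard := by
      rw [← Set.ncard_union_eq _ ((hfin r).subset fun x hx => ⟨hx.1.1.1, hx.2⟩)
        ((hfin r).subset fun x hx => ⟨hx.1, hx.2.2⟩)]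
      · congr 1
        ext x
        simp only [Set.mem_ofPred_eq, Set.mem_sdiff, Set.mem_union]
        have := hU x
        tauto
      · rw [Set.disjoint_left]
        intro x hx hx'
        exact hx'.2.1 hx.1.1.2
    rw [Set.ncard_image_of_injective _ (add_left_injective p)] at h₁
    omega
  ext s
  simp only [map_add, PowerSeries.coeff_X_pow_mul', map_sub]
  split_ifs with hs
  · obtain ⟨r, rfl⟩ := Nat.exists_eq_add_of_le' hs
    have := congrArg (Nat.cast (R := ℚ)) (key r)
    push_cast at this
    simp only [fibreSeries, PowerSeries.coeff_mk, Nat.add_sub_cancel]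
    linarith
  · simp only [fibreSeries, PowerSeries.coeff_mk, add_zero]
    congr 3
    ext x
    simp only [Set.mem_sdiff, Set.mem_union, Set.add_singleton,
      Set.mem_image, not_or, not_exists, not_and]
    constructor
    · rintro ⟨⟨hx, hxU⟩, rfl⟩
      refine ⟨⟨hx, hxU, ?_⟩, rfl⟩
      rintro y - rfl
      simp at hs
    · rintro ⟨⟨hx, hxU, -⟩, hw⟩
      exact ⟨⟨hx, hxU⟩, hw⟩

/-- A difference of invariant subsets of a finitely generated periodic set has a rational
counting series. -/
theorem isRationalSeries_fibreSeries_sdiff [IsCancelAdd N] (w : N →+ ℕ) (l : List N)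
    (hl : ∀ p ∈ l, w p = 0 → p = 0) (F T U : Set N) (hF : F.Finite)
    (hT : T = F + (AddSubmonoid.closure {x | x ∈ l} : Set N))
    (hU : ∀ x ∈ U, ∀ m ∈ AddSubmonoid.closure {x | x ∈ l}, x + m ∈ U)
    (hfin : ∀ r, {x ∈ T | w x = r}.Finite) :
    IsRationalSeries (fibreSeries w (T \ U)) := by
  induction l generalizing F T U with
  | nil =>
    apply isRationalSeries_fibreSeries_of_finite
    refine Set.Finite.subset ?_ Set.sdiff_subset
    simpa [hT] using hF
  | cons p l ih =>
    have hle := closure_le_closure_cons p l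
    have hpl : p ∈ AddSubmonoid.closure {x | x ∈ p :: l} :=
      AddSubmonoid.subset_closure List.mem_cons_self
    specialize ih fun p hp => hl p (List.mem_cons_of_mem _ hp)
    rcases (w p).eq_zero_or_pos with hp | hp
    · obtain rfl := hl p List.mem_cons_self hp
      have h0 : AddSubmonoid.closure {x | x ∈ 0 :: l} = AddSubmonoid.closure {x | x ∈ l} := by
        refine le_antisymm (fun m hm => ?_) hle
        obtain ⟨k, m', hm', rfl⟩ := mem_closure_cons hm
        simpa using hm'
      rw [h0] at hT hU
      exact ih F T U hF hT hU hfin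
    have invariant {F : Set N} {x m : N}
        (hx : x ∈ F + (AddSubmonoid.closure {x | x ∈ p :: l} : Set N))
        (hm : m ∈ AddSubmonoid.closure {x | x ∈ p :: l}) :
        x + m ∈ F + (AddSubmonoid.closure {x | x ∈ p :: l} : Set N) := by
      obtain ⟨f, hf, n, hn, rfl⟩ := Set.mem_add.1 hx
      exact Set.mem_add.2 ⟨f, hf, n + m, add_mem hn hm, by rw [add_assoc]⟩
    have split {F : Set N} {x : N}
        (hx : x ∈ F + (AddSubmonoid.closure {x | x ∈ p :: l} : Set N)) :
        x ∈ F + (AddSubmonoid.closure {x | x ∈ l} : Set N) ∨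
          ∃ y ∈ F + (AddSubmonoid.closure {x | x ∈ p :: l} : Set N), x = y + p := by
      obtain ⟨f, hf, n, hn, rfl⟩ := Set.mem_add.1 hx
      obtain ⟨k, m, hm, rfl⟩ := mem_closure_cons hn
      rcases k with _ | k
      · left
        simpa using Set.add_mem_add hf hm
      · right
        refine ⟨f + (k • p + m), Set.add_mem_add hf ?_, by rw [succ_nsmul]; abel⟩
        exact add_mem (nsmul_mem hpl k) (hle hm)
    have hTinv : ∀ x ∈ T, ∀ m ∈ AddSubmonoid.closure {x | x ∈ p :: l}, x + m ∈ T := by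
      rw [hT]
      exact fun x hx m hm => invariant hx hm
    have sub {F : Set N} : F + (AddSubmonoid.closure {x | x ∈ l} : Set N) ⊆
        F + (AddSubmonoid.closure {x | x ∈ p :: l} : Set N) := Set.add_subset_add_left hle
    have hcoker : IsRationalSeries (fibreSeries w (T \ (U ∪ (T + {p})))) := by
      have : T \ (U ∪ (T + {p})) =
          (F + (AddSubmonoid.closure {x | x ∈ l} : Set N)) \ (U ∪ (T + {p})) := by
        apply subset_antisymm
        · rintro x ⟨hx, hx'⟩
          refine ⟨?_, hx'⟩
          rw [hT] at hx
          rcases split hx with h | ⟨y, hy, rfl⟩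
          · exact h
          · rw [← hT] at hy
            exact absurd (Or.inr (Set.add_mem_add hy (Set.mem_singleton p))) hx'
        · rintro x ⟨hx, hx'⟩
          exact ⟨hT ▸ sub hx, hx'⟩
      rw [this]
      refine ih F _ _ hF rfl ?_ fun r => (hfin r).subset fun x hx => ⟨hT ▸ sub hx.1, hx.2⟩
      rintro x (hx | hx) m hm
      · exact Or.inl (hU x hx m (hle hm))
      · rw [Set.add_singleton] at hx ⊢
        obtain ⟨y, hy, rfl⟩ := hx
        exact Or.inr ⟨y + m, hTinv y hy m (hle hm), add_right_comm y m p⟩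
    have hker : IsRationalSeries (fibreSeries w ({x ∈ T | x + p ∈ U} \ U)) := by
      have hinv : ∀ x ∈ {x ∈ T | x + p ∈ U}, ∀ m ∈ AddSubmonoid.closure {x | x ∈ p :: l},
          x + m ∈ {x ∈ T | x + p ∈ U} := by
        rintro x ⟨hx, hxU⟩ m hm
        refine ⟨hTinv x hx m hm, ?_⟩
        rw [add_right_comm]
        exact hU _ hxU m hm
      obtain ⟨F', hF', h⟩ := exists_finite_add_eq_of_add_mem
        (P := AddSubmonoid.closure {x | x ∈ p :: l})
        ((AddSubmonoid.fg_iff _).2 ⟨_, rfl, List.finite_toSet _⟩) hF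
        (hT ▸ (fun x hx => hx.1 : {x ∈ T | x + p ∈ U} ⊆ T)) hinv
      have : {x ∈ T | x + p ∈ U} \ U =
          (F' + (AddSubmonoid.closure {x | x ∈ l} : Set N)) \ U := by
        apply subset_antisymm
        · rintro x ⟨hx, hx'⟩
          refine ⟨?_, hx'⟩
          rw [h] at hx
          rcases split hx with hx | ⟨y, hy, rfl⟩
          · exact hx
          · rw [← h] at hy
            exact absurd hy.2 hx'
        · rintro x ⟨hx, hx'⟩
          exact ⟨h ▸ sub hx, hx'⟩
      rw [this]
      refine ih F' _ _ hF' rfl (fun x hx m hm => hU x hx m (hle hm)) fun r =>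
        (hfin r).subset fun x hx => ⟨?_, hx.2⟩
      have := sub hx.1
      rw [← h] at this
      exact this.1
    apply IsRationalSeries.of_polynomial_mul (p := 1 - Polynomial.X ^ w p)
    · simp [Polynomial.coeff_X_pow, hp.ne]
    have h := fibreSeries_translate w (p := p) (fun x hx => hTinv x hx p hpl)
      (fun x hx => hU x hx p hpl) hfin
    convert hcoker.sub (hker.polynomial_mul (Polynomial.X ^ w p)) using 1
    push_cast
    linear_combination h

end PeriodicSets

section SemilinearSets

open Pointwise

variable {N : Type*} [AddCommMonoid N]

/-- A hybrid linear set: a finitely generated set over a finitely generated monoid of periods. -/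
def IsHybridLinearSet (s : Set N) : Prop :=
  ∃ (F : Set N) (P : AddSubmonoid N), F.Finite ∧ P.FG ∧ s = F + (P : Set N)

theorem IsLinearSet.isHybridLinearSet {s : Set N} (hs : IsLinearSet s) : IsHybridLinearSet s := by
  obtain ⟨a, P, hP, rfl⟩ := isLinearSet_iff_exists_fg_eq_vadd.1 hs
  exact ⟨{a}, P, Set.finite_singleton a, hP, (Set.singleton_add ..).symm⟩

theorem exists_finite_vadd_inter_vadd [IsCancelAdd N] {P Q : AddSubmonoid N} (hP : P.FG)
    (hQ : Q.FG) (a b : N) :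
    ∃ F : Set N, F.Finite ∧
      ({a} + (P : Set N)) ∩ ({b} + (Q : Set N)) = F + ((P ⊓ Q : AddSubmonoid N) : Set N) := by
  obtain ⟨n, g, rfl⟩ := AddSubmonoid.fg_iff_exists_fin_addMonoidHom.1 hP
  obtain ⟨m, h, rfl⟩ := AddSubmonoid.fg_iff_exists_fin_addMonoidHom.1 hQ
  let sol (u : (Fin n → ℕ) × (Fin m → ℕ)) : Prop := a + g u.1 = b + h u.2
  refine ⟨(fun u => a + g u.1) '' {u | Minimal sol u}, Set.Finite.image _ ?_, ?_⟩
  · exact (setOfPred_minimal_antichain _).finite_of_partiallyWellOrderedOn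
      (Set.isPWO_of_wellQuasiOrderedLE _)
  · apply subset_antisymm
    · rintro x ⟨hx, hx'⟩
      rw [Set.singleton_add] at hx hx'
      obtain ⟨_, ⟨u, rfl⟩, hx⟩ := hx
      obtain ⟨_, ⟨v, rfl⟩, hx'⟩ := hx'
      have huv : sol (u, v) := hx.trans hx'.symm
      obtain ⟨y, hy, hmin⟩ :=
        (Set.isPWO_of_wellQuasiOrderedLE {u | sol u}).exists_le_minimal huv
      obtain ⟨d, hd⟩ := exists_add_of_le hy
      obtain ⟨rfl, rfl⟩ : u = y.1 + d.1 ∧ v = y.2 + d.2 :=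
        ⟨congrArg Prod.fst hd, congrArg Prod.snd hd⟩
      have hgd : g d.1 = h d.2 := by
        have h₁ : a + g y.1 = b + h y.2 := hmin.1
        have h₂ : a + g (y.1 + d.1) = b + h (y.2 + d.2) := huv
        rw [map_add, map_add, ← add_assoc, ← add_assoc, h₁] at h₂
        exact add_left_cancel h₂
      refine Set.mem_add.2 ⟨a + g y.1, ⟨y, hmin, rfl⟩, g d.1, ⟨⟨d.1, rfl⟩, d.2, hgd.symm⟩, ?_⟩
      rw [← hx]
      simp [add_assoc]
    · intro x hx
      obtain ⟨_, ⟨y, hy, rfl⟩, z, ⟨⟨u, hu⟩, v, hv⟩, rfl⟩ := Set.mem_add.1 hx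
      rw [Set.singleton_add, Set.singleton_add]
      refine ⟨⟨_, ⟨y.1 + u, rfl⟩, ?_⟩, _, ⟨y.2 + v, rfl⟩, ?_⟩
      · simp [hu, add_assoc]
      · have h₁ : a + g y.1 = b + h y.2 := hy.1
        simp [hv, h₁, ← add_assoc]

theorem AddSubmonoid.FG.inf_of_isCancelAdd [IsCancelAdd N] {P Q : AddSubmonoid N} (hP : P.FG)
    (hQ : Q.FG) : (P ⊓ Q).FG := by
  obtain ⟨n, g, rfl⟩ := AddSubmonoid.fg_iff_exists_fin_addMonoidHom.1 hP
  obtain ⟨m, h, rfl⟩ := AddSubmonoid.fg_iff_exists_fin_addMonoidHom.1 hQ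
  convert (AddSubmonoid.fg_eqLocusM (g.comp (AddMonoidHom.fst (Fin n → ℕ) (Fin m → ℕ)))
    (h.comp (AddMonoidHom.snd _ _))).map (g.comp (AddMonoidHom.fst _ _)) using 1
  ext x
  constructor
  · rintro ⟨⟨u, rfl⟩, v, hv⟩
    exact ⟨(u, v), hv.symm, rfl⟩
  · rintro ⟨⟨u, v⟩, huv, rfl⟩
    exact ⟨⟨u, rfl⟩, v, Eq.symm huv⟩

theorem IsHybridLinearSet.inter [IsCancelAdd N] {s t : Set N} (hs : IsHybridLinearSet s)
    (ht : IsHybridLinearSet t) : IsHybridLinearSet (s ∩ t) := by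
  obtain ⟨F, P, hF, hP, rfl⟩ := hs
  obtain ⟨F', Q, hF', hQ, rfl⟩ := ht
  choose K hK hK' using fun a b => exists_finite_vadd_inter_vadd hP hQ a b
  refine ⟨⋃ a ∈ F, ⋃ b ∈ F', K a b, P ⊓ Q,
    hF.biUnion fun a _ => hF'.biUnion fun b _ => hK a b, hP.inf_of_isCancelAdd hQ, ?_⟩
  ext x
  simp only [Set.iUnion_add, Set.mem_iUnion, ← hK', Set.mem_inter_iff, exists_prop]
  constructor
  · rintro ⟨⟨a, ha, p, hp, rfl⟩, b, hb, q, hq, hx⟩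
    exact ⟨a, ha, b, hb, Set.add_mem_add rfl hp, hx ▸ Set.add_mem_add rfl hq⟩
  · rintro ⟨a, ha, b, hb, hx, hx'⟩
    exact ⟨Set.add_subset_add_right (by simpa) hx, Set.add_subset_add_right (by simpa) hx'⟩

variable [IsCancelAdd N] [IsAddTorsionFree N]

theorem IsHybridLinearSet.isRationalSeries_fibreSeries {s : Set N} (hs : IsHybridLinearSet s)
    (w : N →+ ℕ) (hfin : ∀ r, {x ∈ s | w x = r}.Finite) :
    IsRationalSeries (fibreSeries w s) := by
  obtain ⟨F, P, hF, ⟨S, rfl⟩, rfl⟩ := hs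
  rcases F.eq_empty_or_nonempty with rfl | ⟨f, hf⟩
  · exact isRationalSeries_fibreSeries_of_finite _ (by simp)
  rw [← Set.sdiff_empty (s := F + _)]
  refine isRationalSeries_fibreSeries_sdiff w S.toList ?_ F _ ∅ hF
    (by simp only [Finset.mem_toList]; rfl) (by simp) hfin
  intro p hp hwp
  by_contra hp0
  refine Set.infinite_of_injective_forall_mem (f := fun n : ℕ => f + n • p) ?_ ?_ (hfin (w f))
  · refine Function.Injective.of_lt_imp_ne fun n m hnm h => hp0 ?_
    obtain ⟨k, rfl⟩ := Nat.exists_eq_add_of_lt hnm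
    have hk : n • p + 0 = n • p + (k + 1) • p := by
      rw [add_zero, ← add_nsmul, ← add_assoc]
      exact add_left_cancel h
    exact nsmul_right_injective k.succ_ne_zero
      ((add_left_cancel hk).symm.trans (nsmul_zero _).symm)
  · intro n
    exact ⟨Set.add_mem_add hf (nsmul_mem (AddSubmonoid.subset_closure (by simpa using hp)) n),
      by simp [hwp]⟩

theorem isRationalSeries_fibreSeries_sUnion (w : N →+ ℕ) (l : List (Set N))
    (hl : ∀ s ∈ l, IsHybridLinearSet s) (hfin : ∀ s ∈ l, ∀ r, {x ∈ s | w x = r}.Finite) :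
    IsRationalSeries (fibreSeries w (⋃₀ {s | s ∈ l})) := by
  induction hn : l.length generalizing l with
  | zero =>
    rw [List.length_eq_zero_iff] at hn
    exact isRationalSeries_fibreSeries_of_finite _ (by simp [hn])
  | succ n ih =>
    obtain ⟨s, l, rfl⟩ := List.exists_of_length_succ l hn
    have hn : l.length = n := by simpa using hn
    simp only [List.mem_cons, forall_eq_or_imp] at hl hfin
    have h₁ : ⋃₀ {t | t ∈ s :: l} = s ∪ ⋃₀ {t | t ∈ l} := by
      ext x; simp
    have h₂ : s ∩ ⋃₀ {t | t ∈ l} = ⋃₀ {t | t ∈ l.map (s ∩ ·)} := by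
      ext x; simp; tauto
    rw [h₁, fibreSeries_union_add_inter w hfin.1, h₂]
    · refine ((hl.1.isRationalSeries_fibreSeries w hfin.1).add
        (ih l hl.2 hfin.2 hn)).sub (ih _ ?_ ?_ (by simpa using hn))
      · simp only [List.mem_map, forall_exists_index, and_imp, forall_apply_eq_imp_iff₂]
        exact fun t ht => hl.1.inter (hl.2 t ht)
      · simp only [List.mem_map, forall_exists_index, and_imp, forall_apply_eq_imp_iff₂]
        exact fun t ht r => (hfin.1 r).subset fun x hx => ⟨hx.1.1, hx.2⟩
    · intro r
      refine ((List.finite_toSet l).biUnion fun t ht => hfin.2 t ht r).subset ?_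
      rintro x ⟨⟨t, ht, hx⟩, hr⟩
      exact Set.mem_biUnion ht ⟨hx, hr⟩

/-- Counting points of a semilinear set along the fibres of a homomorphism to `ℕ` gives a rational
power series. -/
theorem IsSemilinearSet.isRationalSeries_fibreSeries {s : Set N} (hs : IsSemilinearSet s)
    (w : N →+ ℕ) (hfin : ∀ r, {x ∈ s | w x = r}.Finite) :
    IsRationalSeries (fibreSeries w s) := by
  obtain ⟨S, hS, rfl⟩ := isSemilinearSet_iff.1 hs
  have : (S : Set (Set N)) = {t | t ∈ S.toList} := by ext; simp
  rw [this] at hfin ⊢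
  refine isRationalSeries_fibreSeries_sUnion w _ ?_ ?_
  · exact fun t ht => (hS t (by simpa using ht)).isHybridLinearSet
  · exact fun t ht r => (hfin r).subset fun x hx => ⟨⟨t, ht, hx.1⟩, hx.2⟩

end SemilinearSets

section Quotients

open Pointwise

theorem isSemilinearSet_setOf_lex_lt (k : ℕ) :
    IsSemilinearSet {x : (Fin k → ℕ) × (Fin k → ℕ) | toLex x.1 < toLex x.2} := by
  have hlt (i : Fin k) : IsSemilinearSet {x : (Fin k → ℕ) × (Fin k → ℕ) | x.1 i < x.2 i} := by
    let f : (Fin k → ℕ) × (Fin k → ℕ) →+ ℕ × ℕ :=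
      ((Pi.evalAddMonoidHom (fun _ => ℕ) i).comp (AddMonoidHom.fst _ _)).prod
        ((Pi.evalAddMonoidHom (fun _ => ℕ) i).comp (AddMonoidHom.snd _ _))
    have h : IsSemilinearSet {x : ℕ × ℕ | x.1 < x.2} := by
      convert ((IsSemilinearSet.univ (M := ℕ × ℕ)).image
        ((AddMonoidHom.fst ℕ ℕ).prod (AddMonoidHom.fst ℕ ℕ + AddMonoidHom.snd ℕ ℕ))).vadd
          (0, 1) using 1
      ext ⟨a, b⟩
      simp only [Set.mem_ofPred_eq, Set.image_univ, Set.mem_vadd_set, Set.mem_range]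
      constructor
      · intro h
        refine ⟨_, ⟨(a, b - a - 1), rfl⟩, ?_⟩
        simp only [AddMonoidHom.prod_apply, vadd_eq_add, Prod.mk_add_mk, AddMonoidHom.add_apply,
          AddMonoidHom.coe_fst, AddMonoidHom.coe_snd, Prod.mk.injEq]
        omega
      · rintro ⟨_, ⟨⟨c, d⟩, rfl⟩, h⟩
        simp only [AddMonoidHom.prod_apply, vadd_eq_add, Prod.mk_add_mk, AddMonoidHom.add_apply,
          AddMonoidHom.coe_fst, AddMonoidHom.coe_snd, Prod.mk.injEq] at h
        omega
    exact h.preimage f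
  have heq (i : Fin k) : IsSemilinearSet {x : (Fin k → ℕ) × (Fin k → ℕ) | x.1 i = x.2 i} := by
    simpa using isSemilinearSet_setOfPred_eq (0 : ℕ) 0
      ((Pi.evalAddMonoidHom (fun _ => ℕ) i).comp
        (AddMonoidHom.fst (Fin k → ℕ) (Fin k → ℕ)))
      ((Pi.evalAddMonoidHom (fun _ => ℕ) i).comp (AddMonoidHom.snd _ _))
  convert IsSemilinearSet.iUnion fun i : Fin k =>
    (IsSemilinearSet.biInter (Set.toFinite {j | j < i}) fun j _ => heq j).inter (hlt i) using 1
  ext ⟨x, y⟩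
  simp only [Set.mem_ofPred_eq, Set.mem_iUnion, Set.mem_inter_iff, Set.mem_iInter]
  rfl

/-- Given a semilinear family `E` of subsets of a finitely generated commutative monoid and a
semilinear relation which is an equivalence relation on it, the series counting the
equivalence classes is rational. -/
theorem isRationalSeries_ncard_image {B X : Type*} [AddCommMonoid B] [AddMonoid.FG B]
    {E : Set (B × ℕ)} {R : Set (B × B)} (hE : IsSemilinearSet E) (hR : IsSemilinearSet R)
    (cl : B → X) (hcl : ∀ x y r, (x, r) ∈ E → (y, r) ∈ E → ((x, y) ∈ R ↔ cl x = cl y))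
    (hfin : ∀ r, (cl '' {x | (x, r) ∈ E}).Finite) :
    IsRationalSeries (PowerSeries.mk fun r => ((cl '' {x | (x, r) ∈ E}).ncard : ℚ)) := by
  obtain ⟨k, h, hh⟩ := AddSubmonoid.fg_iff_exists_fin_addMonoidHom.1 (AddMonoid.FG.fg_top (M := B))
  rw [AddMonoidHom.mrange_eq_top] at hh
  let M := Fin k → ℕ
  let codes : Set (M × ℕ) := h.prodMap (AddMonoidHom.id ℕ) ⁻¹' E
  let related : Set (M × M) := h.prodMap h ⁻¹' R
  let smaller : Set ((M × M) × ℕ) :=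
    {x | (x.1.2, x.2) ∈ codes ∧ x.1 ∈ related ∧ toLex x.1.2 < toLex x.1.1}
  have hcodes : IsSemilinearSet codes := hE.preimage _
  have hsmaller : IsSemilinearSet smaller := by
    refine IsSemilinearSet.inter ?_ (IsSemilinearSet.inter ?_ ?_)
    · exact hcodes.preimage (((AddMonoidHom.snd M M).prodMap (AddMonoidHom.id ℕ)))
    · exact (hR.preimage (h.prodMap h)).preimage (AddMonoidHom.fst (M × M) ℕ)
    · exact (isSemilinearSet_setOf_lex_lt k).preimage
        (((AddMonoidHom.snd M M).prod (AddMonoidHom.fst M M)).comp (AddMonoidHom.fst (M × M) ℕ))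
  let reps : Set (M × ℕ) := codes \ ((AddMonoidHom.fst M M).prodMap (AddMonoidHom.id ℕ) '' smaller)
  have hreps : IsSemilinearSet reps := hcodes.sdiff (hsmaller.image _)
  have mem_reps {x : M} {r : ℕ} : (x, r) ∈ reps ↔ (h x, r) ∈ E ∧
      ∀ y : M, (h y, r) ∈ E → cl (h x) = cl (h y) → ¬ toLex y < toLex x := by
    constructor
    · rintro ⟨hx, hx'⟩
      refine ⟨hx, fun y hy hxy hlt => hx' ⟨((x, y), r), ⟨hy, ?_, hlt⟩, rfl⟩⟩
      exact (hcl _ _ r hx hy).2 hxy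
    · rintro ⟨hx, hx'⟩
      refine ⟨hx, ?_⟩
      rintro ⟨⟨⟨x, y⟩, r⟩, ⟨hy, hxy, hlt⟩, hxr⟩
      obtain ⟨rfl, rfl⟩ := Prod.ext_iff.1 hxr
      exact hx' y hy ((hcl _ _ _ hx hy).1 hxy) hlt
  have hinj (r : ℕ) : Set.InjOn (fun x => cl (h x.1)) {x ∈ reps | x.2 = r} := by
    rintro ⟨x, r⟩ ⟨hx, rfl⟩ ⟨y, s⟩ ⟨hy, hs⟩ hxy
    dsimp only at hs hxy
    subst hs
    rw [mem_reps] at hx hy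
    have := le_antisymm (not_lt.1 (hx.2 y hy.1 hxy)) (not_lt.1 (hy.2 x hx.1 hxy.symm))
    rw [toLex_inj.1 this]
  have himage (r : ℕ) :
      (fun x => cl (h x.1)) '' {x ∈ reps | x.2 = r} = cl '' {x | (x, r) ∈ E} := by
    apply subset_antisymm
    · rintro _ ⟨⟨x, r⟩, ⟨hx, rfl⟩, rfl⟩
      exact ⟨h x, (mem_reps.1 hx).1, rfl⟩
    · rintro _ ⟨b, hb, rfl⟩
      obtain ⟨x, rfl⟩ := hh b
      obtain ⟨y, ⟨hy, hyx⟩, hmin⟩ := WellFounded.has_min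
        (wellFounded_lt (α := Lex M)) {y | (h (ofLex y), r) ∈ E ∧ cl (h (ofLex y)) = cl (h x)}
        ⟨toLex x, hb, rfl⟩
      refine ⟨(ofLex y, r), ⟨mem_reps.2 ⟨hy, fun z hz hyz => ?_⟩, rfl⟩, hyx⟩
      exact hmin (toLex z) ⟨hz, hyz.symm.trans hyx⟩
  convert hreps.isRationalSeries_fibreSeries (AddMonoidHom.snd M ℕ) ?_ using 1
  · ext r
    simp only [fibreSeries, PowerSeries.coeff_mk, AddMonoidHom.coe_snd]
    rw [← himage r, (hinj r).ncard_image]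
  · intro r
    exact Set.Finite.of_finite_image ((himage r).symm ▸ hfin r) (hinj r)

end Quotients

section Walks

open Pointwise

/-- Labelled walks of positive length whose intermediate vertices lie in `B`. -/
inductive LabelledWalk {Q N : Type*} [AddMonoid N] (E : Q → N → Q → Prop) (B : Set Q) :
    Q → N → Q → Prop
  | edge {i j : Q} {x : N} (h : E i x j) : LabelledWalk E B i x j
  | comp {i k j : Q} {x y : N} (hx : LabelledWalk E B i x k) (hk : k ∈ B)
      (hy : LabelledWalk E B k y j) : LabelledWalk E B i (x + y) j

namespace LabelledWalk

variable {Q N : Type*} [AddCommMonoid N] {E : Q → N → Q → Prop}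

theorem mono {B C : Set Q} (hBC : B ⊆ C) {i j : Q} {x : N} (h : LabelledWalk E B i x j) :
    LabelledWalk E C i x j := by
  induction h with
  | edge h => exact edge h
  | comp _ hk _ hx hy => exact comp hx (hBC hk) hy

theorem setOf_insert (B : Set Q) (k i j : Q) :
    {x | LabelledWalk E (insert k B) i x j} = {x | LabelledWalk E B i x j} ∪
      ({x | LabelledWalk E B i x k} + (AddSubmonoid.closure {x | LabelledWalk E B k x k} : Set N) +
        {x | LabelledWalk E B k x j}) := by
  have hmono {i j : Q} {x : N} : LabelledWalk E B i x j → LabelledWalk E (insert k B) i x j :=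
    mono (Set.subset_insert k B)
  apply subset_antisymm
  · intro x h
    induction h with
    | edge h => exact Or.inl (edge h)
    | comp _ hk _ hx hy =>
      rcases hk with rfl | hk
      · rcases hx with hx | ⟨_, ⟨a, ha, c, hc, rfl⟩, b, hb, rfl⟩ <;>
          rcases hy with hy | ⟨_, ⟨a', ha', c', hc', rfl⟩, b', hb', rfl⟩ <;> right
        · exact ⟨_, ⟨_, hx, 0, zero_mem _, rfl⟩, _, hy, by simp⟩
        · exact ⟨_, ⟨_, hx, _, add_mem (AddSubmonoid.subset_closure ha') hc', rfl⟩, _, hb',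
            by simp [add_assoc]⟩
        · exact ⟨_, ⟨_, ha, _, add_mem hc (AddSubmonoid.subset_closure hb), rfl⟩, _, hy,
            by simp [add_assoc]⟩
        · exact ⟨_, ⟨_, ha, _, add_mem (add_mem hc (AddSubmonoid.subset_closure hb))
            (add_mem (AddSubmonoid.subset_closure ha') hc'), rfl⟩, _, hb', by simp [add_assoc]⟩
      · rcases hx with hx | ⟨_, ⟨a, ha, c, hc, rfl⟩, b, hb, rfl⟩ <;>
          rcases hy with hy | ⟨_, ⟨a', ha', c', hc', rfl⟩, b', hb', rfl⟩
        · exact Or.inl (comp hx hk hy)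
        · exact Or.inr ⟨_, ⟨_, comp hx hk ha', _, hc', rfl⟩, _, hb', by simp [add_assoc]⟩
        · exact Or.inr ⟨_, ⟨_, ha, _, hc, rfl⟩, _, comp hb hk hy, by simp [add_assoc]⟩
        · exact Or.inr ⟨_, ⟨_, ha, _, add_mem hc (add_mem
            (AddSubmonoid.subset_closure (comp hb hk ha')) hc'), rfl⟩, _, hb', by simp [add_assoc]⟩
  · rintro x (h | ⟨_, ⟨a, ha, c, hc, rfl⟩, b, hb, rfl⟩)
    · exact hmono h
    · refine comp ?_ (Set.mem_insert k B) (hmono hb)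
      replace ha : LabelledWalk E (insert k B) i a k := hmono ha
      clear hb
      induction hc using AddSubmonoid.closure_induction generalizing a with
      | mem c hc => exact comp ha (Set.mem_insert k B) (hmono hc)
      | zero => simpa using ha
      | add c d _ _ hc hd => simpa [add_assoc] using hd _ (hc _ ha)

/-- Kleene's argument for commutative labels: the labels of the walks between two vertices of a
finite graph form a semilinear set. -/
theorem isSemilinearSet [Finite Q] (hE : ∀ i j, {x | E i x j}.Finite) (i j : Q) :
    IsSemilinearSet {x | LabelledWalk E Set.univ i x j} := by
  suffices h : ∀ B : Set Q, B.Finite → ∀ i j, IsSemilinearSet {x | LabelledWalk E B i x j} from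
    h _ Set.finite_univ i j
  intro B hB
  induction B, hB using Set.Finite.induction_on with
  | empty =>
    intro i j
    refine IsSemilinearSet.of_finite ((hE i j).subset ?_)
    rintro x (h | ⟨_, hk, _⟩)
    exacts [h, hk.elim]
  | insert _ _ ih =>
    intro i j
    rw [setOf_insert]
    exact (ih i j).union (((ih _ _).add (ih _ _).closure).add (ih _ _))

end LabelledWalk

end Walks

section WordWeights

variable {G : Type*} [Group G] {S : Finset G} {ω : G → ℕ}

theorem inducedWeight_le_iff (hgen : ∀ g : G, ∃ l : List G, (∀ s ∈ l, s ∈ S) ∧ l.prod = g)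
    {g : G} {r : ℕ} :
    inducedWeight S ω g ≤ r ↔
      ∃ l : List G, (∀ s ∈ l, s ∈ S) ∧ l.prod = g ∧ (l.map ω).sum ≤ r := by
  by_cases hg : g = 1
  · simp only [inducedWeight, if_pos hg, zero_le, true_iff]
    exact ⟨[], by simp [hg]⟩
  · simp only [inducedWeight, if_neg hg]
    constructor
    · intro h
      obtain ⟨l, hl, hl'⟩ := hgen g
      obtain ⟨l, hl, hl', hw⟩ := Nat.sInf_mem
        (s := {w : ℕ | ∃ l : List G, (∀ s ∈ l, s ∈ S) ∧ l.prod = g ∧ (l.map ω).sum = w})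
        ⟨_, l, hl, hl', rfl⟩
      exact ⟨l, hl, hl', hw ▸ h⟩
    · rintro ⟨l, hl, hl', hw⟩
      refine le_trans (Nat.sInf_le ?_) hw
      exact ⟨l, hl, hl', rfl⟩

theorem finite_setOf_inducedWeight_le
    (hgen : ∀ g : G, ∃ l : List G, (∀ s ∈ l, s ∈ S) ∧ l.prod = g) (hω : ∀ s ∈ S, 0 < ω s)
    (r : ℕ) : {g | inducedWeight S ω g ≤ r}.Finite := by
  refine ((List.finite_length_le {s // s ∈ S} r).image fun l => (l.map Subtype.val).prod).subset ?_
  intro g hg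
  obtain ⟨l, hl, hlg, hw⟩ := (inducedWeight_le_iff hgen).1 hg
  lift l to List {s // s ∈ S} using hl
  refine ⟨l, ?_, hlg⟩
  have : (l.map fun _ => 1).sum ≤ (l.map fun s : {s // s ∈ S} => ω s).sum :=
    List.sum_le_sum fun s _ => hω s s.2
  have hw' : (l.map fun s : {s // s ∈ S} => ω s).sum ≤ r := by
    simpa [Function.comp_def] using hw
  simpa using this.trans hw'

end WordWeights

section VirtuallyAbelian

open Pointwise
open scoped IsMulCommutative

variable {G : Type*} [Group G]

theorem Subgroup.exists_fin_transversal (H : Subgroup G) [H.FiniteIndex] :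
    ∃ (n : ℕ) (t : Fin n → G), ∀ x, ∃ i, ∃ a ∈ H, x = a * t i := by
  obtain ⟨n, ⟨e⟩⟩ := Finite.exists_equiv_fin (G ⧸ H)
  refine ⟨n, fun i => (e.symm i).out⁻¹, fun x => ⟨e (QuotientGroup.mk x⁻¹),
    x * (QuotientGroup.mk (s := H) x⁻¹).out, ?_, ?_⟩⟩
  · have := QuotientGroup.eq.1 (QuotientGroup.out_eq' (QuotientGroup.mk (s := H) x⁻¹)).symm
    simpa using this
  · simp

variable (A : Subgroup G) [IsMulCommutative A] (S : Finset G) (ω : G → ℕ)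

theorem isSemilinearSet_setOf_word {n : ℕ} {t : Fin n → G}
    (ht : ∀ x, ∃ i, ∃ a ∈ A, x = a * t i) (i j : Fin n) :
    IsSemilinearSet {p : Additive A × ℕ | ∃ l : List G, l ≠ [] ∧ (∀ s ∈ l, s ∈ S) ∧
      t i * l.prod = (p.1.toMul : G) * t j ∧ (l.map ω).sum = p.2} := by
  let E (i : Fin n) (p : Additive A × ℕ) (j : Fin n) : Prop :=
    ∃ s ∈ S, t i * s = (p.1.toMul : G) * t j ∧ ω s = p.2
  have hE (i j) : {p | E i p j}.Finite := by
    refine (S.finite_toSet.biUnion fun s _ => Set.Subsingleton.finite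
      (s := {p : Additive A × ℕ | t i * s = (p.1.toMul : G) * t j ∧ ω s = p.2}) ?_).subset ?_
    · rintro ⟨a, m⟩ ⟨ha, rfl⟩ ⟨b, k⟩ ⟨hb, rfl⟩
      have := mul_right_cancel (ha.symm.trans hb)
      exact Prod.ext (Additive.toMul.injective (Subtype.ext this)) rfl
    · rintro p ⟨s, hs, hp⟩
      exact Set.mem_biUnion hs hp
  convert LabelledWalk.isSemilinearSet hE i j using 1
  ext p
  constructor
  · rintro ⟨l, hne, hl, hp⟩
    induction l generalizing i p with
    | nil => exact (hne rfl).elim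
    | cons s l ih =>
      rcases eq_or_ne l [] with rfl | hne
      · exact .edge ⟨s, hl s (by simp), by simpa using hp⟩
      · obtain ⟨k, a, ha, hak⟩ := ht (t i * s)
        obtain ⟨b, m⟩ := p
        have hw := ih k (Additive.ofMul (⟨a, ha⟩⁻¹ * b.toMul), (l.map ω).sum) hne
          (fun x hx => hl x (by simp [hx])) ⟨?_, rfl⟩
        · have he : E i (Additive.ofMul ⟨a, ha⟩, ω s) k := ⟨s, hl s (by simp), hak, rfl⟩
          have hp2 : ω s + (l.map ω).sum = m := by simpa using hp.2
          have hb : (b, m) = (Additive.ofMul ⟨a, ha⟩, ω s) +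
              (Additive.ofMul (⟨a, ha⟩⁻¹ * b.toMul), (l.map ω).sum) :=
            Prod.ext (Additive.toMul.injective (by simp)) hp2.symm
          exact hb ▸ LabelledWalk.comp (.edge he) (Set.mem_univ k) hw
        · have hp1 : t i * (s * l.prod) = b.toMul * t j := by simpa using hp.1
          rw [← mul_assoc, hak] at hp1
          simp [mul_assoc, ← hp1]
  · intro h
    induction h with
    | edge h =>
      obtain ⟨s, hs, h⟩ := h
      exact ⟨[s], by simp, by simpa using hs, by simpa using h⟩
    | comp _ _ _ hx hy =>
      obtain ⟨l, hne, hl, hp⟩ := hx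
      obtain ⟨l', hne', hl', hp'⟩ := hy
      refine ⟨l ++ l', by simp [hne], ?_, ?_, ?_⟩
      · intro s hs
        exact (List.mem_append.1 hs).elim (hl s) (hl' s)
      · rw [List.prod_append, ← mul_assoc, hp.1, mul_assoc, hp'.1]
        simp [mul_assoc]
      · simp [hp.2, hp'.2]

variable {S} in
theorem isSemilinearSet_setOf_inducedWeight_le
    (hgen : ∀ g : G, ∃ l : List G, (∀ s ∈ l, s ∈ S) ∧ l.prod = g) {n : ℕ} {t : Fin n → G}
    (ht : ∀ x, ∃ i, ∃ a ∈ A, x = a * t i) (j : Fin n) :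
    IsSemilinearSet {p : Additive A × ℕ | inducedWeight S ω (p.1.toMul * t j) ≤ p.2} := by
  obtain ⟨i, a, ha, hai⟩ := ht 1
  lift a to A using ha
  let Z := {p : Additive A × ℕ | p.1.toMul * t j = 1 ∧ p.2 = 0}
  have hZ : Z.Finite := Set.Subsingleton.finite fun p hp q hq => by
    refine Prod.ext (Additive.toMul.injective (Subtype.ext ?_)) (hp.2.trans hq.2.symm)
    exact mul_right_cancel (hp.1.trans hq.1.symm)
  convert ((IsSemilinearSet.of_finite hZ).union ((isSemilinearSet_setOf_word A S ω ht i j).vadd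
    (Additive.ofMul a, 0))).add
    (IsSemilinearSet.univ.image (AddMonoidHom.inr (Additive A) ℕ)) using 1
  ext ⟨c, r⟩
  simp only [Set.mem_ofPred_eq, inducedWeight_le_iff hgen]
  constructor
  · rintro ⟨l, hl, hlc, hw⟩
    obtain ⟨k, rfl⟩ := Nat.exists_eq_add_of_le hw
    rcases eq_or_ne l [] with rfl | hne
    · exact ⟨(c, 0), Or.inl ⟨hlc.symm, rfl⟩, (0, k), ⟨k, trivial, rfl⟩, by simp⟩
    · refine ⟨(c, (l.map ω).sum), Or.inr ?_, (0, k), ⟨k, trivial, rfl⟩, by simp⟩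
      refine ⟨(-Additive.ofMul a + c, (l.map ω).sum), ⟨l, hne, hl, ?_, rfl⟩, by simp⟩
      rw [hlc, eq_inv_mul_of_mul_eq hai.symm]
      simp [mul_assoc]
  · rintro ⟨_, h | ⟨⟨b, m⟩, ⟨l, -, hl, hlb, rfl⟩, rfl⟩, _, ⟨k, -, rfl⟩, h'⟩
    · obtain ⟨rfl, rfl⟩ := Prod.ext_iff.1 h'
      exact ⟨[], by simp, by simpa using h.1.symm, by simp⟩
    · obtain ⟨rfl, rfl⟩ := Prod.ext_iff.1 h'
      refine ⟨l, hl, ?_, by simp⟩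
      rw [← one_mul l.prod, hai, mul_assoc, hlb]
      simp [mul_assoc]

theorem isSemilinearSet_setOf_twistedConj [A.Normal] [A.FiniteIndex] [Group.FG A] (φ : G →* G)
    (g h : G) :
    IsSemilinearSet {p : Additive A × Additive A |
      ∃ x : G, (p.2.toMul : G) * h = x * (p.1.toMul * g) * (φ x)⁻¹} := by
  have : (A.comap φ).FiniteIndex :=
    ⟨Subgroup.index_comap A φ ▸
      Subgroup.FiniteIndex.index_ne_zero (H := A.subgroupOf φ.range)⟩
  let K : Subgroup A := (A.comap φ).subgroupOf A
  let ψ : K →* A := ((φ.comp A.subtype).comp K.subtype).codRestrict A fun e => e.2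
  have hψ (e : K) : (ψ e : G) = φ e := rfl
  obtain ⟨n, y, hy⟩ := (A ⊓ A.comap φ).exists_fin_transversal
  have hpiece (i : Fin n) : IsSemilinearSet {p : Additive A × Additive A |
      ∃ e : K, (p.2.toMul : G) * h = e * y i * (p.1.toMul * g) * (φ (e * y i))⁻¹} := by
    by_cases hu : ∃ u : A, y i * g * (φ (y i))⁻¹ = u * h
    · obtain ⟨u, hu⟩ := hu
      let f : Additive A × Additive K →+ Additive A × Additive A :=
        (AddMonoidHom.fst _ _).prod
          ((MulAut.conjNormal (y i)).toMonoidHom.toAdditive.comp (AddMonoidHom.fst _ _) +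
            (K.subtype.toAdditive - (MulAut.conjNormal h).toMonoidHom.toAdditive.comp
              ψ.toAdditive).comp (AddMonoidHom.snd _ _))
      convert (IsSemilinearSet.univ.image f).vadd (0, Additive.ofMul u) using 1
      ext ⟨a, b⟩
      have key (e : K) : (e : G) * y i * (a.toMul * g) * (φ (e * y i))⁻¹ =
          (u * (MulAut.conjNormal (y i) a.toMul * (e * (MulAut.conjNormal h (ψ e))⁻¹)) : A) * h := by
        have hcomm : (e : G) * (MulAut.conjNormal (y i) a.toMul : A) * u =
            u * ((MulAut.conjNormal (y i) a.toMul : A) * e) :=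
          congrArg Subtype.val ((mul_comm _ u).trans (congrArg (u * ·) (mul_comm (e : A) _)))
        calc
          (e : G) * y i * (a.toMul * g) * (φ (e * y i))⁻¹
          _ = e * (MulAut.conjNormal (y i) a.toMul : A) * (y i * g * (φ (y i))⁻¹) * (φ e)⁻¹ := by
            simp [mul_assoc]
          _ = e * (MulAut.conjNormal (y i) a.toMul : A) * u * h * (φ e)⁻¹ := by
            rw [hu]; simp only [mul_assoc]
          _ = _ := by
            rw [hcomm]
            simp [mul_assoc, hψ]
      have hf (e : Additive K) : (0, Additive.ofMul u) + f (a, e) = (a, Additive.ofMul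
          (u * (MulAut.conjNormal (y i) a.toMul *
            (e.toMul * (MulAut.conjNormal h (ψ e.toMul))⁻¹)))) := by
        refine Prod.ext (zero_add a) ?_
        simp [f, sub_eq_add_neg]
      constructor
      · rintro ⟨e, he⟩
        refine ⟨_, ⟨(a, Additive.ofMul e), trivial, rfl⟩, (hf _).trans (Prod.ext rfl ?_)⟩
        rw [key] at he
        exact Additive.toMul.injective (Subtype.ext (mul_right_cancel he).symm)
      · rintro ⟨_, ⟨⟨a', e⟩, -, rfl⟩, he⟩
        obtain rfl : a' = a := by simpa [f] using congrArg Prod.fst he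
        refine ⟨e.toMul, ?_⟩
        rw [key, ← (Prod.ext_iff.1 ((hf e).symm.trans he)).2]
        rfl
    · convert IsSemilinearSet.empty using 1
      ext ⟨a, b⟩
      simp only [Set.mem_ofPred_eq, Set.mem_empty_iff_false, iff_false]
      rintro ⟨e, he⟩
      refine hu ⟨(MulAut.conjNormal (y i) a.toMul)⁻¹ * (e : A)⁻¹ * b.toMul *
        MulAut.conjNormal h (ψ e), ?_⟩
      have : y i * g * (φ (y i))⁻¹ = (y i * a.toMul * (y i)⁻¹)⁻¹ * (e : G)⁻¹ *
          (e * y i * (a.toMul * g) * (φ (e * y i))⁻¹) * φ e := by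
        simp only [map_mul]
        group
      rw [this, ← he]
      simp [mul_assoc, hψ]
  convert IsSemilinearSet.iUnion hpiece using 1
  ext p
  simp only [Set.mem_ofPred_eq, Set.mem_iUnion]
  constructor
  · rintro ⟨x, hx⟩
    obtain ⟨i, e, ⟨he, he'⟩, rfl⟩ := hy x
    exact ⟨i, ⟨⟨e, he⟩, he'⟩, hx⟩
  · rintro ⟨i, e, hx⟩
    exact ⟨_, hx⟩

end VirtuallyAbelian

section TwistedConjugacy

open Pointwise
open scoped IsMulCommutative

variable {G : Type*} [Group G]

/-- The `φ`-twisted conjugacy class of `g`. -/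
def twistedConjClass (φ : G →* G) (g : G) : Set G :=
  {h : G | ∃ x : G, h = x * g * (φ x)⁻¹}

theorem mem_twistedConjClass_self (φ : G →* G) (g : G) : g ∈ twistedConjClass φ g :=
  ⟨1, by simp⟩

theorem twistedConjClass_eq_iff {φ : G →* G} {g h : G} :
    twistedConjClass φ g = twistedConjClass φ h ↔ ∃ x : G, h = x * g * (φ x)⁻¹ := by
  constructor
  · intro hgh
    have := mem_twistedConjClass_self φ h
    rwa [← hgh] at this
  · rintro ⟨x, rfl⟩
    ext k
    constructor
    · rintro ⟨y, rfl⟩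
      exact ⟨y * x⁻¹, by simp [mul_assoc]⟩
    · rintro ⟨y, rfl⟩
      exact ⟨y * x, by simp [mul_assoc]⟩

theorem isRationalSeries_ncard_twistedConjClass (A : Subgroup G) [IsMulCommutative A] [A.Normal]
    [A.FiniteIndex] [Group.FG G] {S : Finset G}
    (hgen : ∀ g : G, ∃ l : List G, (∀ s ∈ l, s ∈ S) ∧ l.prod = g)
    {ω : G → ℕ} (hω : ∀ s ∈ S, 0 < ω s) (φ : G →* G) :
    IsRationalSeries (PowerSeries.mk fun r =>
      (({C | (∃ g, C = twistedConjClass φ g) ∧ ∃ h ∈ C, inducedWeight S ω h ≤ r} : Set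
        (Set G)).ncard : ℚ)) := by
  obtain ⟨n, t, ht⟩ := A.exists_fin_transversal
  obtain ⟨t, rfl⟩ : ∃ t' : ℕ → G, t = fun i : Fin n => t' i :=
    ⟨fun m => if hm : m < n then t ⟨m, hm⟩ else 1, by simp⟩
  let elt (p : Additive A × ℕ) : G := p.1.toMul * t p.2
  let E : Set ((Additive A × ℕ) × ℕ) := {q | q.1.2 < n ∧ inducedWeight S ω (elt q.1) ≤ q.2}
  let R : Set ((Additive A × ℕ) × (Additive A × ℕ)) := {q | q.1.2 < n ∧ q.2.2 < n ∧
    ∃ x, elt q.2 = x * elt q.1 * (φ x)⁻¹}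
  have hE : IsSemilinearSet E := by
    convert IsSemilinearSet.iUnion fun i : Fin n =>
      ((isSemilinearSet_setOf_inducedWeight_le A ω hgen ht i).image
        ((AddMonoidHom.inl (Additive A) ℕ).prodMap (AddMonoidHom.id ℕ))).vadd ((0, (i : ℕ)), 0)
      using 1
    ext ⟨⟨a, m⟩, r⟩
    rw [Set.mem_iUnion]
    constructor
    · rintro ⟨hm, h⟩
      exact ⟨⟨m, hm⟩, _, ⟨(a, r), h, rfl⟩, by simp⟩
    · rintro ⟨i, _, ⟨⟨b, k⟩, h, rfl⟩, hb⟩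
      obtain ⟨⟨rfl, rfl⟩, rfl⟩ : (b = a ∧ (i : ℕ) = m) ∧ k = r := by simpa using hb
      exact ⟨i.2, h⟩
  have hR : IsSemilinearSet R := by
    convert IsSemilinearSet.iUnion fun i : Fin n => IsSemilinearSet.iUnion fun j : Fin n =>
      ((isSemilinearSet_setOf_twistedConj A φ (t i) (t j)).image
        ((AddMonoidHom.inl (Additive A) ℕ).prodMap (AddMonoidHom.inl (Additive A) ℕ))).vadd
          ((0, (i : ℕ)), (0, (j : ℕ))) using 1
    ext ⟨⟨a, m⟩, ⟨b, k⟩⟩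
    simp only [Set.mem_iUnion]
    constructor
    · rintro ⟨hm, hk, h⟩
      exact ⟨⟨m, hm⟩, ⟨k, hk⟩, _, ⟨(a, b), h, rfl⟩, by simp⟩
    · rintro ⟨i, j, _, ⟨⟨a', b'⟩, h, rfl⟩, hab⟩
      obtain ⟨⟨rfl, rfl⟩, rfl, rfl⟩ : (a' = a ∧ (i : ℕ) = m) ∧ b' = b ∧ (j : ℕ) = k := by
        simpa using hab
      exact ⟨i.2, j.2, h⟩
  have himage (r : ℕ) : (fun p => twistedConjClass φ (elt p)) '' {p | (p, r) ∈ E} =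
      {C | (∃ g, C = twistedConjClass φ g) ∧ ∃ h ∈ C, inducedWeight S ω h ≤ r} := by
    apply subset_antisymm
    · rintro _ ⟨p, hp, rfl⟩
      exact ⟨⟨_, rfl⟩, _, mem_twistedConjClass_self φ _, hp.2⟩
    · rintro _ ⟨⟨g, rfl⟩, h, hh, hr⟩
      obtain ⟨i, a, ha, rfl⟩ := ht h
      exact ⟨(Additive.ofMul ⟨a, ha⟩, i), ⟨i.2, hr⟩, (twistedConjClass_eq_iff.2 hh).symm⟩
  simp only [← himage]
  refine isRationalSeries_ncard_image hE hR _ ?_ ?_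
  · rintro x y r ⟨hx, -⟩ ⟨hy, -⟩
    rw [twistedConjClass_eq_iff]
    exact ⟨fun h => h.2.2, fun h => ⟨hx, hy, h⟩⟩
  · intro r
    refine ((finite_setOf_inducedWeight_le hgen hω r).image (twistedConjClass φ)).subset ?_
    rintro _ ⟨p, hp, rfl⟩
    exact ⟨_, hp.2, rfl⟩

end TwistedConjugacy

/-- Let `G` be a finitely generated virtually abelian group, `S` a finite
monoid generating set with weight function `ω : S → ℕ₊`, and `φ` an endomorphism of `G`.
Let `c r` be the number of `φ`-twisted conjugacy classes of `G` containing an element of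
weight at most `r`. Then `∑ c(r) zʳ` is a rational power series. -/
theorem twisted_conjugacy_growth_series_rational {G : Type*} [Group G]
    (hVA : ∃ A : Subgroup G, A.index ≠ 0 ∧ ∀ x ∈ A, ∀ y ∈ A, x * y = y * x)
    (S : Finset G) (hgen : ∀ g : G, ∃ l : List G, (∀ s ∈ l, s ∈ S) ∧ l.prod = g)
    (ω : G → ℕ) (hω : ∀ s ∈ S, 0 < ω s) (φ : G →* G)
    (c : ℕ → ℕ)
    (hc : ∀ r : ℕ, c r = Set.ncard {C : Set G |
      (∃ g : G, C = {h : G | ∃ x : G, h = x * g * (φ x)⁻¹}) ∧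
      ∃ h ∈ C, inducedWeight S ω h ≤ r}) :
    ∃ p q : Polynomial ℚ, q.coeff 0 ≠ 0 ∧
      (q : PowerSeries ℚ) * PowerSeries.mk (fun r => (c r : ℚ)) = (p : PowerSeries ℚ) := by
  obtain ⟨A, hA, hcomm⟩ := hVA
  have : A.FiniteIndex := ⟨hA⟩
  have : IsMulCommutative A.normalCore := ⟨⟨fun x y => Subtype.ext
    (hcomm x (A.normalCore_le x.2) y (A.normalCore_le y.2))⟩⟩
  have : Group.FG G := ⟨S, eq_top_iff.2 fun g _ => by
    obtain ⟨l, hl, rfl⟩ := hgen g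
    exact list_prod_mem fun s hs => Subgroup.subset_closure (hl s hs)⟩
  simp only [hc]
  exact isRationalSeries_ncard_twistedConjClass A.normalCore hgen hω φ
end

section
/- Every finitely generated infinite virtually abelian group G has a normal subgroup N of finite index such that N is isomorphic (as a group) to ℤⁿ for some n ≥ 1, and N is fully characteristic, i.e. φ(N) ⊆ N for every endomorphism φ of G. -/
open scoped IsMulCommutative

/-- The torsion subgroup of a finitely generated commutative group is finite. -/
theorem CommGroup.finite_torsion_of_fg (A : Type*) [CommGroup A] [Group.FG A] :
    Finite (CommGroup.torsion A) := by
  have : Module.Finite ℤ (Additive A) := Module.Finite.iff_addGroup_fg.mpr inferInstance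
  have : Finite (Submodule.torsion ℤ (Additive A)) :=
    Module.finite_of_fg_torsion _ (Submodule.torsion_isTorsion)
  have h : Finite (AddCommGroup.torsion (Additive A)) := by
    rw [← Submodule.torsion_int]
    exact this
  exact h

/-- In a finitely generated commutative group, some power map kills all torsion. -/
theorem CommGroup.exists_pow_eq_one_of_isOfFinOrder (A : Type*) [CommGroup A] [Group.FG A] :
    ∃ e : ℕ, e ≠ 0 ∧ ∀ a : A, IsOfFinOrder a → a ^ e = 1 := by
  have := CommGroup.finite_torsion_of_fg A
  refine ⟨Nat.card (CommGroup.torsion A), Nat.card_pos.ne', fun a ha ↦ ?_⟩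
  exact congrArg Subtype.val (pow_card_eq_one' (x := (⟨a, ha⟩ : CommGroup.torsion A)))

/-- The subgroup of `k`-th powers in a finitely generated commutative group has finite index. -/
theorem CommGroup.index_range_powMonoidHom_ne_zero (A : Type*) [CommGroup A] [Group.FG A]
    {k : ℕ} (hk : k ≠ 0) : (powMonoidHom k : A →* A).range.index ≠ 0 := by
  have : Finite (A ⧸ (powMonoidHom k : A →* A).range) :=
    CommGroup.finite_of_fg_isMulTorsion _ (CommGroup.isMulTorsion_quotient_range_powMonoidHom A hk)
  exact Subgroup.index_ne_zero_of_finite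

/-- An infinite finitely generated torsion-free commutative group is isomorphic to `ℤⁿ` for some
`n ≥ 1`. -/
theorem CommGroup.exists_mulEquiv_int_pow (A : Type*) [CommGroup A] [Group.FG A] [Infinite A]
    [IsMulTorsionFree A] :
    ∃ n : ℕ, 1 ≤ n ∧ Nonempty (A ≃* Multiplicative (Fin n → ℤ)) := by
  have : Module.Finite ℤ (Additive A) := Module.Finite.iff_addGroup_fg.mpr inferInstance
  let b := Module.finBasis ℤ (Additive A)
  refine ⟨Module.finrank ℤ (Additive A), ?_, ⟨b.equivFun.toAddEquiv.toMultiplicativeRight⟩⟩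
  by_contra! h
  have : IsEmpty (Fin (Module.finrank ℤ (Additive A))) := by
    rw [Nat.lt_one_iff.mp h]
    infer_instance
  have : Finite (Additive A) := Finite.of_equiv _ b.equivFun.symm.toEquiv
  exact not_finite (Additive A)

/-- The subgroup generated by all `k`-th powers of elements of `G`. -/
def Subgroup.powClosure (G : Type*) [Group G] (k : ℕ) : Subgroup G :=
  Subgroup.closure (Set.range fun g : G ↦ g ^ k)

theorem Subgroup.map_mem_powClosure {G : Type*} [Group G] {k : ℕ} (φ : G →* G) {x : G}
    (hx : x ∈ Subgroup.powClosure G k) : φ x ∈ Subgroup.powClosure G k := by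
  have h : Subgroup.powClosure G k ≤ (Subgroup.powClosure G k).comap φ := by
    refine (Subgroup.closure_le _).mpr ?_
    rintro _ ⟨g, rfl⟩
    exact Subgroup.subset_closure ⟨φ g, (map_pow φ g k).symm⟩
  exact h hx

/-- Every finitely generated infinite virtually abelian group `G` has a
normal subgroup `N` of finite index such that `N ≅ ℤⁿ` for some `n ≥ 1` and `N` is fully
characteristic (invariant under every endomorphism of `G`). -/
theorem exists_fully_characteristic_free_abelian_finite_index {G : Type*} [Group G]
    (hfg : Group.FG G) (hinf : Infinite G)
    (hVA : ∃ A : Subgroup G, A.index ≠ 0 ∧ ∀ x ∈ A, ∀ y ∈ A, x * y = y * x) :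
    ∃ N : Subgroup G, N.Normal ∧ N.index ≠ 0 ∧
      (∃ n : ℕ, 1 ≤ n ∧ Nonempty (N ≃* Multiplicative (Fin n → ℤ))) ∧
      ∀ φ : G →* G, ∀ x ∈ N, φ x ∈ N := by
  obtain ⟨B, hB, hcomm⟩ := hVA
  have : B.FiniteIndex := ⟨hB⟩
  set A := B.normalCore
  have hAB : A ≤ B := B.normalCore_le
  have : IsMulCommutative A :=
    ⟨⟨fun x y ↦ Subtype.ext (hcomm x (hAB x.2) y (hAB y.2))⟩⟩
  have hA : A.index ≠ 0 := Subgroup.FiniteIndex.index_ne_zero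
  obtain ⟨e, he, htor⟩ := CommGroup.exists_pow_eq_one_of_isOfFinOrder A
  set k := A.index * e
  set N := Subgroup.powClosure G k
  have hNA : N ≤ ((powMonoidHom e : A →* A).range).map A.subtype := by
    refine (Subgroup.closure_le _).mpr ?_
    rintro _ ⟨g, rfl⟩
    exact ⟨_, ⟨⟨g ^ A.index, A.pow_index_mem g⟩, rfl⟩, (pow_mul g _ _).symm⟩
  have hAN : ((powMonoidHom k : A →* A).range).map A.subtype ≤ N := by
    rintro _ ⟨_, ⟨a, rfl⟩, rfl⟩
    exact Subgroup.subset_closure ⟨a, rfl⟩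
  have hN : N.index ≠ 0 := by
    refine ne_zero_of_dvd_ne_zero ?_ (Subgroup.index_dvd_of_le hAN)
    rw [Subgroup.index_map_subtype]
    exact mul_ne_zero (CommGroup.index_range_powMonoidHom_ne_zero A (mul_ne_zero hA he)) hA
  have : N.FiniteIndex := ⟨hN⟩
  have hNA' : N ≤ A := hNA.trans (Subgroup.map_subtype_le _)
  have : IsMulCommutative N :=
    ⟨⟨fun x y ↦ Subtype.ext (hcomm x (hAB (hNA' x.2)) y (hAB (hNA' y.2)))⟩⟩
  have : IsMulTorsionFree N := by
    refine .of_not_isOfFinOrder fun x hx hfin ↦ hx ?_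
    obtain ⟨_, ⟨a, rfl⟩, hax⟩ := hNA x.2
    have hxG : IsOfFinOrder (a ^ e) := by
      rw [← Submonoid.isOfFinOrder_coe] at hfin ⊢
      rwa [← hax] at hfin
    refine Subtype.ext (hax.symm.trans ?_)
    simp [htor a (hxG.of_pow he)]
  have : Infinite N := by
    by_contra hfin
    rw [not_infinite_iff_finite] at hfin
    have : Finite G := Nat.finite_of_card_ne_zero <| by
      rw [← N.card_mul_index]
      exact mul_ne_zero Nat.card_pos.ne' hN
    exact not_finite G
  refine ⟨N, ⟨fun x hx g ↦ ?_⟩, hN, CommGroup.exists_mulEquiv_int_pow N,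
    fun φ x hx ↦ Subgroup.map_mem_powClosure φ hx⟩
  exact Subgroup.map_mem_powClosure (MulAut.conj g).toMonoidHom hx
end
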